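/- Define g(μ) = 6·(1 + √2)·(3 + 3√2 − 16μ)/(6 + 16μ + 3√2)² for μ ≥ 0. Then |g(μ)| ≤ 1 for all μ ≥ 0; moreover g(μ) > 0 for 0 ≤ μ < 3(1 + √2)/16, g(3(1 + √2)/16) = 0, and g(μ) < 0 for μ > 3(1 + √2)/16, so the first positive zero of g is μ = 3(1 + √2)/16 ≈ 0.4526, where g changes sign. -/

import Mathlib

open Set

noncomputable section

/-- Amplification factor at the grid-scale frequency `θ = π` of the implicit
scheme of SSP2(2,2,2) with the fourth-order five-point stencil. -/
def gSSP222fourth (μ : ℝ) : ℝ :=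
  6 * (1 + Real.sqrt 2) * (3 + 3 * Real.sqrt 2 - 16 * μ) / (6 + 16 * μ + 3 * Real.sqrt 2) ^ 2

/-- For `g(μ) = 6(1+√2)(3+3√2−16μ)/(6+16μ+3√2)²`: `|g(μ)| ≤ 1` for all `μ ≥ 0`;
`g` is positive before, zero at, and negative after `μ = 3(1+√2)/16 ≈ 0.4526`,
which is its first positive zero, where it changes sign. -/
theorem ssp222_fourth_amplification :
    (∀ μ : ℝ, 0 ≤ μ → |gSSP222fourth μ| ≤ 1) ∧
    (∀ μ : ℝ, 0 ≤ μ → μ < 3 * (1 + Real.sqrt 2) / 16 → 0 < gSSP222fourth μ) ∧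
    gSSP222fourth (3 * (1 + Real.sqrt 2) / 16) = 0 ∧
    (∀ μ : ℝ, 3 * (1 + Real.sqrt 2) / 16 < μ → gSSP222fourth μ < 0) ∧
    3 * (1 + Real.sqrt 2) / 16 ∈ Ioo (0.4526 : ℝ) 0.4527 := by
  have hs : Real.sqrt 2 ^ 2 = 2 := Real.sq_sqrt (by norm_num)
  have hs0 : 0 < Real.sqrt 2 := by positivity
  have hlow : 1.4142 < Real.sqrt 2 := Real.lt_sqrt_of_sq_lt (by norm_num)
  have hupp : Real.sqrt 2 < 1.4143 := by
    rw [Real.sqrt_lt' (by norm_num)]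
    norm_num
  unfold gSSP222fourth
  refine ⟨fun μ hμ => ?_, fun μ hμ hlt => ?_, ?_, fun μ hlt => ?_, ?_, ?_⟩
  · have hD : 0 < (6 + 16 * μ + 3 * Real.sqrt 2) ^ 2 := by positivity
    have hμs : 0 ≤ μ * Real.sqrt 2 := by positivity
    rw [abs_le, le_div_iff₀ hD, div_le_one hD]
    constructor <;> nlinarith [sq_nonneg μ]
  · exact div_pos (mul_pos (by positivity) (by linarith)) (by positivity)
  · rw [div_eq_zero_iff]
    left
    ring
  · have hμ : 0 < μ := by linarith
    exact div_neg_of_neg_of_pos (mul_neg_of_pos_of_neg (by positivity) (by linarith))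
      (by positivity)
  · linarith
  · linarith
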